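/- Let α ∈ (0,1) and let the temporal mesh be quasi-graded with parameter r ≥ 1 and constants c_0 ≤ C_0. Let u ∈ C([0,T]) ∩ C^2((0,T]) with ψ^1,...,ψ^M finite, and for m = 1,...,M define the truncation error r^m := δ_t^α u(t_m) − D_t^α u(t_m), where δ_t^α is applied to the sequence (u(t_0), u(t_1), ..., u(t_M)) and D_t^α is the Caputo derivative. Then there exists a constant C > 0, depending only on α, r, T, c_0, C_0, such that |r^m| ≤ C (τ/t_m)^{min{α+1, (2−α)/r}} · max_{j=1,...,m} ψ^j for all m = 1,...,M. -/

import Mathlib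

open Real MeasureTheory Set

/-- The L1 discrete fractional-derivative operator associated with the mesh `t`,
applied to the sequence `V`, at time level `m`. -/
noncomputable def deltaL1 (α : ℝ) (t : ℕ → ℝ) (V : ℕ → ℝ) (m : ℕ) : ℝ :=
  (1 / Real.Gamma (1 - α)) *
    ∑ j ∈ Finset.Icc 1 m,
      ((V j - V (j - 1)) / (t j - t (j - 1))) *
        ∫ s in (t (j - 1))..(t j), (t m - s) ^ (-α)

/-- `t 0 = 0 < t 1 < ... < t M = T` with `M ≥ 2`. -/
def IsMesh (T : ℝ) (M : ℕ) (t : ℕ → ℝ) : Prop :=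
  2 ≤ M ∧ t 0 = 0 ∧ (∀ j, j < M → t j < t (j + 1)) ∧ t M = T

/-- Quasi-graded mesh with parameter `r` and constants `c0 ≤ C0`. -/
def QuasiGraded (r c0 C0 : ℝ) (M : ℕ) (t : ℕ → ℝ) : Prop :=
  (c0 * (M : ℝ) ^ (-r) ≤ t 1 ∧ t 1 ≤ C0 * (M : ℝ) ^ (-r)) ∧
  (∀ j : ℕ, 1 ≤ j → j ≤ M →
    c0 * (t 1 * (j : ℝ) ^ r) ≤ t j ∧ t j ≤ C0 * (t 1 * (j : ℝ) ^ r)) ∧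
  (∀ j : ℕ, 1 ≤ j → j ≤ M →
    c0 * ((t 1) ^ (1 / r) * (t j) ^ (1 - 1 / r)) ≤ t j - t (j - 1) ∧
    t j - t (j - 1) ≤ C0 * ((t 1) ^ (1 / r) * (t j) ^ (1 - 1 / r)))

/-- The stability majorant `𝒱^j`. -/
noncomputable def Vcal (α γ τ tj : ℝ) : ℝ :=
  if 0 < γ then τ * tj ^ (α - 1)
  else if γ = 0 then τ * tj ^ (α - 1) * (1 + Real.log (tj / τ))
  else τ * tj ^ (α - 1) * (τ / tj) ^ γ

/-- The Caputo fractional derivative of order `α`. -/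
noncomputable def caputo (α : ℝ) (u : ℝ → ℝ) (t : ℝ) : ℝ :=
  (1 / Real.Gamma (1 - α)) * ∫ s in (0:ℝ)..t, (t - s) ^ (-α) * deriv u s

/-- The quantities `ψ^j` of (3.3): `ψ^1 = sup_{s∈(0,t_1)} s^{1-α} |δ_t u(t_1) - u'(s)|`
and `ψ^j = t_j^{2-α} sup_{s∈(t_{j-1},t_j)} |u''(s)|` for `j ≥ 2`. -/
noncomputable def psiL1 (α : ℝ) (t : ℕ → ℝ) (u : ℝ → ℝ) (j : ℕ) : ℝ :=
  if j = 1 then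
    sSup ((fun s => s ^ (1 - α) *
      |(u (t 1) - u (t 0)) / (t 1 - t 0) - deriv u s|) '' Set.Ioo 0 (t 1))
  else (t j) ^ (2 - α) *
    sSup ((fun s => |deriv (deriv u) s|) '' Set.Ioo (t (j - 1)) (t j))

/-- A measurable function dominated on an open interval by an integrable function is integrable,
and its integral is bounded by that of the dominating function. -/
lemma intervalIntegrable_and_abs_integral_le_of_dominated {f G : ℝ → ℝ} {a b : ℝ} (hab : a ≤ b)
    (hf : Measurable f) (hfG : ∀ s ∈ Ioo a b, |f s| ≤ G s)
    (hG : IntervalIntegrable G volume a b) :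
    IntervalIntegrable f volume a b ∧ |∫ s in a..b, f s| ≤ ∫ s in a..b, G s := by
  have hne : ∀ᵐ s ∂(volume : Measure ℝ), s ≠ b := by
    simp [ae_iff, measure_singleton]
  have hae : ∀ᵐ s ∂(volume : Measure ℝ), s ∈ Ioc a b → ‖f s‖ ≤ G s := by
    filter_upwards [hne] with s hs hsI
    exact hfG s ⟨hsI.1, lt_of_le_of_ne hsI.2 hs⟩
  refine ⟨hG.mono_fun' hf.aestronglyMeasurable ?_,
    intervalIntegral.norm_integral_le_of_norm_le hab hae hG⟩
  rw [uIoc_of_le hab]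
  exact (ae_restrict_iff' measurableSet_Ioc).2 hae

/-- The deviation of the derivative from the mean slope has zero mean. -/
lemma integral_slope_sub_deriv {u G : ℝ → ℝ} {a b : ℝ} (hab : a < b)
    (hu : ContinuousOn u (Icc a b)) (hd : ∀ s ∈ Ioo a b, DifferentiableAt ℝ u s)
    (hG : IntervalIntegrable G volume a b)
    (hgG : ∀ s ∈ Ioo a b, |(u b - u a) / (b - a) - deriv u s| ≤ G s) :
    IntervalIntegrable (fun s => (u b - u a) / (b - a) - deriv u s) volume a b ∧
      ∫ s in a..b, ((u b - u a) / (b - a) - deriv u s) = 0 := by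
  have hI := (intervalIntegrable_and_abs_integral_le_of_dominated hab.le
    (measurable_const.sub (measurable_deriv u)) hgG hG).1
  refine ⟨hI, ?_⟩
  have hc : IntervalIntegrable (fun _ : ℝ => (u b - u a) / (b - a)) volume a b :=
    intervalIntegrable_const
  have hdI : IntervalIntegrable (deriv u) volume a b := by
    simpa using hc.sub hI
  rw [intervalIntegral.integral_sub hc hdI,
    intervalIntegral.integral_eq_sub_of_hasDerivAt_of_le hab.le hu
      (fun s hs => (hd s hs).hasDerivAt) hdI, intervalIntegral.integral_const, smul_eq_mul]
  have : b - a ≠ 0 := by linarith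
  field_simp
  ring

/-- A bound on the second derivative controls the deviation of the derivative from the slope. -/
lemma abs_slope_sub_deriv_le {u : ℝ → ℝ} {a b L : ℝ} (hab : a < b)
    (hu : ContinuousOn u (Icc a b)) (hd : ∀ s ∈ Ioo a b, DifferentiableAt ℝ u s)
    (hd2 : ∀ s ∈ Ioo a b, DifferentiableAt ℝ (deriv u) s)
    (hL : ∀ s ∈ Ioo a b, |deriv (deriv u) s| ≤ L) {s : ℝ} (hs : s ∈ Ioo a b) :
    |(u b - u a) / (b - a) - deriv u s| ≤ L * (b - a) := by
  obtain ⟨ξ, hξ, hξe⟩ := exists_deriv_eq_slope u hab hu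
    (fun x hx => (hd x hx).differentiableWithinAt)
  rw [← hξe]
  have h := (convex_Ioo a b).norm_image_sub_le_of_norm_deriv_le hd2 hL hs hξ
  have hL0 : 0 ≤ L := (abs_nonneg _).trans (hL s hs)
  refine h.trans (mul_le_mul_of_nonneg_left ?_ hL0)
  rw [Real.norm_eq_abs, abs_le]
  constructor <;> linarith [hs.1, hs.2, hξ.1, hξ.2]

lemma measurable_sub_rpow (c β : ℝ) : Measurable fun s : ℝ => (c - s) ^ β :=
  (measurable_const.sub measurable_id).pow_const β

lemma intervalIntegrable_sub_rpow {α : ℝ} (hα1 : α < 1) (a b c : ℝ) :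
    IntervalIntegrable (fun s => (c - s) ^ (-α)) volume a b := by
  have h : IntervalIntegrable (fun x : ℝ => x ^ (-α)) volume (c - a) (c - b) :=
    intervalIntegral.intervalIntegrable_rpow' (by linarith)
  simpa using h.comp_sub_left c

lemma integral_sub_rpow {α : ℝ} (hα1 : α < 1) (a b : ℝ) :
    ∫ s in a..b, (b - s) ^ (-α) = (b - a) ^ (1 - α) / (1 - α) := by
  rw [intervalIntegral.integral_comp_sub_left (fun x : ℝ => x ^ (-α)) b,
    integral_rpow (Or.inl (by linarith))]
  rw [show -α + 1 = 1 - α by ring, sub_self, Real.zero_rpow (by linarith), sub_zero]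

/-- Integrating a mean-zero function against the weakly singular kernel, away from its
singularity. -/
lemma abs_integral_kernel_mul_le {α a b c : ℝ} {g G : ℝ → ℝ} (hα0 : 0 < α)
    (hab : a ≤ b) (hbc : b < c) (hg : Measurable g) (hgG : ∀ s ∈ Ioo a b, |g s| ≤ G s)
    (hG : IntervalIntegrable G volume a b) (hg0 : ∫ s in a..b, g s = 0) :
    IntervalIntegrable (fun s => (c - s) ^ (-α) * g s) volume a b ∧
    |∫ s in a..b, (c - s) ^ (-α) * g s| ≤
      ((c - b) ^ (-α) - (c - a) ^ (-α)) * ∫ s in a..b, G s := by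
  have hgI := (intervalIntegrable_and_abs_integral_le_of_dominated hab hg hgG hG).1
  have h := intervalIntegrable_and_abs_integral_le_of_dominated
    (f := fun s => ((c - s) ^ (-α) - (c - a) ^ (-α)) * g s)
    (G := fun s => ((c - b) ^ (-α) - (c - a) ^ (-α)) * G s) hab
    (((measurable_sub_rpow c (-α)).sub_const _).mul hg) ?_ (hG.const_mul _)
  · have hsplit : (fun s => (c - s) ^ (-α) * g s) =
        fun s => ((c - s) ^ (-α) - (c - a) ^ (-α)) * g s + (c - a) ^ (-α) * g s := by
      funext s; ring
    rw [hsplit]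
    refine ⟨h.1.add (hgI.const_mul _), ?_⟩
    rw [intervalIntegral.integral_add h.1 (hgI.const_mul _),
      intervalIntegral.integral_const_mul, hg0, mul_zero, add_zero,
      ← intervalIntegral.integral_const_mul]
    exact h.2
  · intro s hs
    have h1 : (c - a) ^ (-α) ≤ (c - s) ^ (-α) :=
      Real.rpow_le_rpow_of_nonpos (by linarith [hs.2]) (by linarith [hs.1]) (by linarith)
    have h2 : (c - s) ^ (-α) ≤ (c - b) ^ (-α) :=
      Real.rpow_le_rpow_of_nonpos (by linarith) (by linarith [hs.2]) (by linarith)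
    rw [abs_mul, abs_of_nonneg (by linarith)]
    exact mul_le_mul (by linarith) (hgG s hs) (abs_nonneg _) (by linarith)

lemma rpow_neg_sub_rpow_neg_le {α x y : ℝ} (hα0 : 0 < α) (hx : 0 < x) (hxy : x ≤ y) :
    x ^ (-α) - y ^ (-α) ≤ α * (y - x) * x ^ (-α - 1) := by
  rcases hxy.eq_or_lt with rfl | hlt
  · simp
  obtain ⟨ξ, hξ, he⟩ := exists_hasDerivAt_eq_slope (fun z : ℝ => z ^ (-α))
    (fun z => -α * z ^ (-α - 1)) hlt
    (fun z hz => (Real.continuousAt_rpow_const _ _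
      (Or.inl (by linarith [hz.1]))).continuousWithinAt)
    (fun z hz => Real.hasDerivAt_rpow_const (Or.inl (by linarith [hz.1])))
  have hle : ξ ^ (-α - 1) ≤ x ^ (-α - 1) :=
    Real.rpow_le_rpow_of_nonpos hx hξ.1.le (by linarith)
  have hyx : 0 < y - x := by linarith
  rw [eq_div_iff hyx.ne'] at he
  nlinarith [mul_le_mul_of_nonneg_left hle (mul_nonneg hα0.le hyx.le)]

/-- Bound on the error over the first interval when the evaluation point is its endpoint. -/
lemma abs_integral_beta_kernel_le {α c P : ℝ} {g : ℝ → ℝ} (hα0 : 0 < α) (hα1 : α < 1)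
    (hc : 0 < c) (hg : Measurable g) (hP : 0 ≤ P)
    (hgG : ∀ s ∈ Ioo 0 c, |g s| ≤ P * s ^ (α - 1)) :
    IntervalIntegrable (fun s => (c - s) ^ (-α) * g s) volume 0 c ∧
    |∫ s in (0:ℝ)..c, (c - s) ^ (-α) * g s| ≤
      P * (2 ^ α / α + 2 ^ (1 - α) / (1 - α)) := by
  have hr : IntervalIntegrable (fun s : ℝ => s ^ (α - 1)) volume 0 c :=
    intervalIntegral.intervalIntegrable_rpow' (by linarith)
  have hk := intervalIntegrable_sub_rpow hα1 0 c c
  have h := intervalIntegrable_and_abs_integral_le_of_dominated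
    (f := fun s => (c - s) ^ (-α) * g s)
    (G := fun s => P * ((c / 2) ^ (-α) * s ^ (α - 1) + (c / 2) ^ (α - 1) * (c - s) ^ (-α)))
    hc.le ((measurable_sub_rpow c (-α)).mul hg) ?_
    (((hr.const_mul _).add (hk.const_mul _)).const_mul _)
  · refine ⟨h.1, h.2.trans_eq ?_⟩
    rw [intervalIntegral.integral_const_mul,
      intervalIntegral.integral_add (hr.const_mul _) (hk.const_mul _),
      intervalIntegral.integral_const_mul, intervalIntegral.integral_const_mul,
      integral_sub_rpow hα1, integral_rpow (Or.inl (by linarith)), sub_zero, sub_add_cancel,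
      Real.zero_rpow hα0.ne', sub_zero]
    have e1 : (c / 2) ^ (-α) * (c ^ α / α) = 2 ^ α / α := by
      rw [Real.rpow_neg (by positivity), Real.div_rpow hc.le (by norm_num)]
      have := (Real.rpow_pos_of_pos hc α).ne'
      field_simp
    have e2 : (c / 2) ^ (α - 1) * (c ^ (1 - α) / (1 - α)) = 2 ^ (1 - α) / (1 - α) := by
      rw [show α - 1 = -(1 - α) by ring, Real.rpow_neg (by positivity),
        Real.div_rpow hc.le (by norm_num)]
      have := (Real.rpow_pos_of_pos hc (1 - α)).ne'
      field_simp
    rw [e1, e2]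
  · intro s hs
    have hs0 := hs.1
    have hsc : 0 < c - s := by linarith [hs.2]
    have hp1 : 0 ≤ (c - s) ^ (-α) := by positivity
    have hp2 : 0 ≤ s ^ (α - 1) := by positivity
    have hp3 : 0 ≤ (c / 2) ^ (-α) := by positivity
    have hp4 : 0 ≤ (c / 2) ^ (α - 1) := by positivity
    rw [abs_mul, abs_of_nonneg hp1]
    have key : (c - s) ^ (-α) * s ^ (α - 1) ≤
        (c / 2) ^ (-α) * s ^ (α - 1) + (c / 2) ^ (α - 1) * (c - s) ^ (-α) := by
      rcases le_total s (c / 2) with h2 | h2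
      · have : (c - s) ^ (-α) ≤ (c / 2) ^ (-α) :=
          Real.rpow_le_rpow_of_nonpos (by linarith) (by linarith) (by linarith)
        nlinarith [mul_le_mul_of_nonneg_right this hp2, mul_nonneg hp4 hp1]
      · have : s ^ (α - 1) ≤ (c / 2) ^ (α - 1) :=
          Real.rpow_le_rpow_of_nonpos (by linarith) (by linarith) (by linarith)
        nlinarith [mul_le_mul_of_nonneg_right this hp1, mul_nonneg hp3 hp2]
    calc (c - s) ^ (-α) * |g s| ≤ (c - s) ^ (-α) * (P * s ^ (α - 1)) :=
          mul_le_mul_of_nonneg_left (hgG s hs) hp1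
      _ = P * ((c - s) ^ (-α) * s ^ (α - 1)) := by ring
      _ ≤ _ := mul_le_mul_of_nonneg_left key hP

/-- The truncation error is a sum of local contributions. -/
lemma deltaL1_sub_caputo_eq {α : ℝ} (hα1 : α < 1) {t : ℕ → ℝ} {u : ℝ → ℝ} (m : ℕ)
    (ht0 : t 0 = 0)
    (hI : ∀ j ∈ Finset.Icc 1 m, IntervalIntegrable (fun s => (t m - s) ^ (-α) *
      ((u (t j) - u (t (j - 1))) / (t j - t (j - 1)) - deriv u s)) volume (t (j - 1)) (t j)) :
    deltaL1 α t (fun j => u (t j)) m - caputo α u (t m) =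
      (1 / Real.Gamma (1 - α)) * ∑ j ∈ Finset.Icc 1 m, ∫ s in (t (j - 1))..(t j),
        (t m - s) ^ (-α) * ((u (t j) - u (t (j - 1))) / (t j - t (j - 1)) - deriv u s) := by
  have hcI : ∀ j ∈ Finset.Icc 1 m, IntervalIntegrable
      (fun s => (t m - s) ^ (-α) * deriv u s) volume (t (j - 1)) (t j) := by
    intro j hj
    have := ((intervalIntegrable_sub_rpow hα1 (t (j - 1)) (t j) (t m)).const_mul
      ((u (t j) - u (t (j - 1))) / (t j - t (j - 1)))).sub (hI j hj)
    refine this.congr ?_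
    intro s _
    simp only
    ring
  have hsum : ∫ s in (0:ℝ)..(t m), (t m - s) ^ (-α) * deriv u s =
      ∑ j ∈ Finset.Icc 1 m, ∫ s in (t (j - 1))..(t j), (t m - s) ^ (-α) * deriv u s := by
    rw [← ht0, ← intervalIntegral.sum_integral_adjacent_intervals
      (a := t) (n := m) (fun k hk => hcI (k + 1) (by simp; omega))]
    rw [Finset.range_eq_Ico]
    exact Finset.sum_Ico_add'
      (fun j => ∫ s in (t (j - 1))..(t j), (t m - s) ^ (-α) * deriv u s) 0 m 1
  rw [deltaL1, caputo, hsum, ← mul_sub, ← Finset.sum_sub_distrib]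
  congr 1
  refine Finset.sum_congr rfl fun j hj => ?_
  rw [← intervalIntegral.integral_const_mul, ← intervalIntegral.integral_sub
    ((intervalIntegrable_sub_rpow hα1 _ _ _).const_mul _) (hcI j hj)]
  refine intervalIntegral.integral_congr fun s _ => ?_
  ring

lemma IsMesh.le {T : ℝ} {M : ℕ} {t : ℕ → ℝ} (h : IsMesh T M t) {i j : ℕ} (hij : i ≤ j)
    (hj : j ≤ M) : t i ≤ t j := by
  induction j, hij using Nat.le_induction with
  | base => exact le_rfl
  | succ k hk ih => exact (ih (by omega)).trans (h.2.2.1 k (by omega)).le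

lemma IsMesh.lt {T : ℝ} {M : ℕ} {t : ℕ → ℝ} (h : IsMesh T M t) {i j : ℕ} (hij : i < j)
    (hj : j ≤ M) : t i < t j :=
  (h.2.2.1 i (by omega)).trans_le (h.le (Nat.succ_le_of_lt hij) hj)

lemma IsMesh.pos {T : ℝ} {M : ℕ} {t : ℕ → ℝ} (h : IsMesh T M t) {j : ℕ} (hj1 : 1 ≤ j)
    (hj : j ≤ M) : 0 < t j :=
  h.2.1 ▸ h.lt (i := 0) (by omega) hj

lemma rpow_mul_rpow_one_sub {x y p : ℝ} (hx : 0 < x) (hy : 0 < y) :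
    x ^ p * y ^ (1 - p) = y * (x / y) ^ p := by
  rw [Real.div_rpow hx.le hy.le, Real.rpow_sub hy, Real.rpow_one]
  ring

lemma QuasiGraded.step_bounds {T r c0 C0 : ℝ} {M : ℕ} {t : ℕ → ℝ} (hm : IsMesh T M t)
    (hq : QuasiGraded r c0 C0 M t) {j : ℕ} (hj1 : 1 ≤ j) (hj : j ≤ M) :
    c0 * (t j * (t 1 / t j) ^ (1 / r)) ≤ t j - t (j - 1) ∧
      t j - t (j - 1) ≤ C0 * (t j * (t 1 / t j) ^ (1 / r)) := by
  have h := hq.2.2 j hj1 hj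
  rwa [rpow_mul_rpow_one_sub (hm.pos le_rfl (hj1.trans hj)) (hm.pos hj1 hj)] at h

lemma QuasiGraded.le_mul_pred {T r c0 C0 : ℝ} {M : ℕ} {t : ℕ → ℝ} (hm : IsMesh T M t)
    (hq : QuasiGraded r c0 C0 M t) (hr : 1 ≤ r) (hc0 : 0 < c0) (hcC : c0 ≤ C0)
    {j : ℕ} (hj2 : 2 ≤ j) (hj : j ≤ M) :
    t j ≤ C0 / c0 * 2 ^ r * t (j - 1) := by
  have h1 := (hq.2.1 j (by omega) hj).2
  have h2 := (hq.2.1 (j - 1) (by omega) (by omega)).1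
  have ht : 0 < t 1 := hm.pos le_rfl (by omega)
  have hcast : (j : ℝ) ≤ 2 * ((j - 1 : ℕ) : ℝ) := by
    have : j ≤ 2 * (j - 1) := by omega
    exact_mod_cast this
  have h3 : (j : ℝ) ^ r ≤ 2 ^ r * ((j - 1 : ℕ) : ℝ) ^ r := by
    rw [← Real.mul_rpow (by norm_num) (Nat.cast_nonneg _)]
    exact Real.rpow_le_rpow (Nat.cast_nonneg _) hcast (by linarith)
  have hC : 0 < C0 := hc0.trans_le hcC
  calc t j ≤ C0 * (t 1 * (j : ℝ) ^ r) := h1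
    _ ≤ C0 * (t 1 * (2 ^ r * ((j - 1 : ℕ) : ℝ) ^ r)) := by gcongr
    _ = C0 / c0 * 2 ^ r * (c0 * (t 1 * ((j - 1 : ℕ) : ℝ) ^ r)) := by field_simp
    _ ≤ _ := by gcongr

lemma QuasiGraded.mul_le_sub_first {T r c0 C0 : ℝ} {M : ℕ} {t : ℕ → ℝ} (hm : IsMesh T M t)
    (hq : QuasiGraded r c0 C0 M t) (hr : 1 ≤ r) (hc0 : 0 < c0)
    {m : ℕ} (hm2 : 2 ≤ m) (hmM : m ≤ M) :
    c0 / (1 + c0) * t m ≤ t m - t 1 := by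
  have h1 := (hq.step_bounds hm (j := 2) (by omega) (by omega)).1
  have ht : 0 < t 1 := hm.pos le_rfl (by omega)
  have ht2 : 0 < t 2 := hm.pos (by omega) (by omega)
  have h12 : t 1 ≤ t 2 := hm.le (by omega) (by omega)
  have h2m : t 2 ≤ t m := hm.le hm2 hmM
  have hy1 : t 1 / t 2 ≤ 1 := (div_le_one ht2).2 h12
  have hy : t 1 / t 2 ≤ (t 1 / t 2) ^ (1 / r) := by
    conv_lhs => rw [← Real.rpow_one (t 1 / t 2)]
    exact Real.rpow_le_rpow_of_exponent_ge (by positivity) hy1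
      ((div_le_one (by linarith)).2 hr)
  have h3 : t 1 ≤ t 2 * (t 1 / t 2) ^ (1 / r) := by
    calc t 1 = t 2 * (t 1 / t 2) := by field_simp
      _ ≤ _ := by gcongr
  have h4 : c0 * t 1 ≤ t m - t 1 := by
    have := mul_le_mul_of_nonneg_left h3 hc0.le
    norm_num at h1
    norm_num at this
    linarith
  rw [div_mul_eq_mul_div, div_le_iff₀ (by linarith)]
  linarith

lemma sub_mul_rpow_le {a b K q : ℝ} (ha : 0 < a) (hab : a ≤ b) (hK : b ≤ K * a) (hq : q ≠ 0) :
    (b - a) * b ^ (q - 1) ≤ K ^ |q - 1| * ((b ^ q - a ^ q) / q) := by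
  rcases hab.eq_or_lt with rfl | hlt
  · simp
  obtain ⟨ξ, hξ, he⟩ := exists_hasDerivAt_eq_slope (fun z : ℝ => z ^ q)
    (fun z => q * z ^ (q - 1)) hlt
    (fun z hz => (Real.continuousAt_rpow_const _ _
      (Or.inl (by linarith [hz.1]))).continuousWithinAt)
    (fun z hz => Real.hasDerivAt_rpow_const (Or.inl (by linarith [hz.1])))
  have hba : 0 < b - a := by linarith
  have hξ0 : 0 < ξ := ha.trans hξ.1
  have he' : (b ^ q - a ^ q) / q = (b - a) * ξ ^ (q - 1) := by
    rw [eq_div_iff hba.ne'] at he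
    rw [div_eq_iff hq, ← he]
    ring
  have hK1 : 1 ≤ K := by
    by_contra! h
    nlinarith
  have hbξ : b ≤ K * ξ := hK.trans (by nlinarith [hξ.1])
  have key : b ^ (q - 1) ≤ K ^ |q - 1| * ξ ^ (q - 1) := by
    rcases le_total 0 (q - 1) with h | h
    · rw [abs_of_nonneg h, ← Real.mul_rpow (by linarith) hξ0.le]
      exact Real.rpow_le_rpow (by linarith) hbξ h
    · have h1 : b ^ (q - 1) ≤ ξ ^ (q - 1) := Real.rpow_le_rpow_of_nonpos hξ0 hξ.2.le h
      have h2 : 1 ≤ K ^ |q - 1| := Real.one_le_rpow hK1 (abs_nonneg _)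
      have h3 : 0 < ξ ^ (q - 1) := by positivity
      nlinarith
  rw [he']
  calc (b - a) * b ^ (q - 1) ≤ (b - a) * (K ^ |q - 1| * ξ ^ (q - 1)) := by gcongr
    _ = _ := by ring

lemma sum_Icc_two_sub_pred (f : ℕ → ℝ) (n : ℕ) :
    ∑ j ∈ Finset.Icc 2 (n + 1), (f j - f (j - 1)) = f (n + 1) - f 1 := by
  induction n with
  | zero => simp
  | succ n ih =>
    rw [Finset.sum_Icc_succ_top (by omega), ih]
    simp

lemma sum_Icc_one_eq_add (f : ℕ → ℝ) (n : ℕ) :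
    ∑ j ∈ Finset.Icc 1 (n + 1), f j = f 1 + ∑ j ∈ Finset.Icc 2 (n + 1), f j := by
  induction n with
  | zero => simp
  | succ n ih =>
    rw [Finset.sum_Icc_succ_top (by omega), ih, Finset.sum_Icc_succ_top (a := 2) (b := n + 1) (by omega),
      add_assoc]

/-- An intermediate exponent avoiding the logarithmic case `μ = α + 1`. -/
lemma exists_exponent_ne {α r : ℝ} (hα0 : 0 < α) (hr : 1 ≤ r) :
    ∃ μ : ℝ, min (α + 1) ((2 - α) / r) ≤ μ ∧ μ ≤ 2 / r ∧ α + 1 - μ ≠ 0 := by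
  have hr0 : 0 < r := by linarith
  have h : (2 - α) / r < 2 / r := by gcongr; linarith
  rcases lt_or_ge ((2 - α) / r) (α + 1) with h1 | h1
  · exact ⟨(2 - α) / r, min_le_right _ _, h.le, by linarith⟩
  · exact ⟨2 / r, (min_le_right _ _).trans h.le, le_rfl, by linarith⟩

lemma QuasiGraded.exists_sum_weight_mul_step_le {α r c0 C0 : ℝ} (hα0 : 0 < α) (hr : 1 ≤ r)
    (hc0 : 0 < c0) (hcC : c0 ≤ C0) :
    ∃ K : ℝ, 0 ≤ K ∧ ∀ (T : ℝ) (M : ℕ) (t : ℕ → ℝ), IsMesh T M t → QuasiGraded r c0 C0 M t →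
      ∀ n : ℕ, n + 2 ≤ M →
        ∑ j ∈ Finset.Icc 2 (n + 1), (t 1 / t j) ^ (2 / r) * t j ^ α * (t j - t (j - 1)) ≤
          K * (t (n + 2) ^ (α + 1) *
            (t 1 / t (n + 2)) ^ min (α + 1) ((2 - α) / r)) := by
  obtain ⟨μ, hμ1, hμ2, hμ⟩ := exists_exponent_ne hα0 hr
  set q := α + 1 - μ with hqd
  set ρ := min (α + 1) ((2 - α) / r) with hρ
  have hC : 0 < C0 := hc0.trans_le hcC
  set A := (C0 / c0 * 2 ^ r) ^ |q - 1| with hA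
  have hA0 : 0 ≤ A := by positivity
  refine ⟨A / |q|, by positivity, fun T M t hm hq n hn => ?_⟩
  have ht1 : 0 < t 1 := hm.pos le_rfl (by omega)
  have htm : 0 < t (n + 2) := hm.pos (by omega) hn
  have htn : 0 < t (n + 1) := hm.pos (by omega) (by omega)
  have ht1m : t 1 ≤ t (n + 2) := hm.le (by omega) hn
  have hterm : ∀ j ∈ Finset.Icc 2 (n + 1),
      (t 1 / t j) ^ (2 / r) * t j ^ α * (t j - t (j - 1)) ≤
        t 1 ^ μ * A / q * ((fun j => t j ^ q) j - (fun j => t j ^ q) (j - 1)) := by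
    intro j hj
    rw [Finset.mem_Icc] at hj
    have htj : 0 < t j := hm.pos (by omega) (by omega)
    have h1j : t 1 ≤ t j := hm.le (by omega) (by omega)
    have hst : t (j - 1) ≤ t j := hm.le (by omega) (by omega)
    have h1 : (t 1 / t j) ^ (2 / r) ≤ (t 1 / t j) ^ μ :=
      Real.rpow_le_rpow_of_exponent_ge (by positivity) ((div_le_one htj).2 h1j) hμ2
    have h2 : (t 1 / t j) ^ μ * t j ^ α = t 1 ^ μ * t j ^ (q - 1) := by
      rw [Real.div_rpow ht1.le htj.le, show q - 1 = α - μ by rw [hqd]; ring, Real.rpow_sub htj]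
      ring
    have h3 := sub_mul_rpow_le (hm.pos (j := j - 1) (by omega) (by omega)) hst
      (hq.le_mul_pred hm hr hc0 hcC hj.1 (by omega)) hμ
    have hp : 0 ≤ t j ^ α * (t j - t (j - 1)) := mul_nonneg (by positivity) (by linarith)
    calc (t 1 / t j) ^ (2 / r) * t j ^ α * (t j - t (j - 1))
        = (t 1 / t j) ^ (2 / r) * (t j ^ α * (t j - t (j - 1))) := by ring
      _ ≤ (t 1 / t j) ^ μ * (t j ^ α * (t j - t (j - 1))) := by gcongr
      _ = ((t 1 / t j) ^ μ * t j ^ α) * (t j - t (j - 1)) := by ring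
      _ = t 1 ^ μ * ((t j - t (j - 1)) * t j ^ (q - 1)) := by rw [h2]; ring
      _ ≤ t 1 ^ μ * (A * ((t j ^ q - t (j - 1) ^ q) / q)) := by gcongr
      _ = _ := by ring
  refine (Finset.sum_le_sum hterm).trans ?_
  rw [← Finset.mul_sum, sum_Icc_two_sub_pred (fun j => t j ^ q) n]
  have hY : 0 < t 1 / t (n + 2) := by positivity
  have hY1 : t 1 / t (n + 2) ≤ 1 := (div_le_one htm).2 ht1m
  have key : t 1 ^ μ * ((t (n + 1) ^ q - t 1 ^ q) / q) ≤
      1 / |q| * (t (n + 2) ^ (α + 1) * (t 1 / t (n + 2)) ^ ρ) := by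
    rcases lt_or_gt_of_ne hμ with hneg | hpos
    · have hb : (t (n + 1) ^ q - t 1 ^ q) / q ≤ 1 / |q| * t 1 ^ q := by
        rw [abs_of_neg hneg, div_le_iff_of_neg hneg]
        have : 0 < t (n + 1) ^ q := by positivity
        have hq' : 1 / -q * t 1 ^ q * q = - t 1 ^ q := by field_simp
        linarith
      calc t 1 ^ μ * ((t (n + 1) ^ q - t 1 ^ q) / q) ≤ t 1 ^ μ * (1 / |q| * t 1 ^ q) := by gcongr
        _ = 1 / |q| * t 1 ^ (α + 1) := by
            rw [mul_left_comm, ← Real.rpow_add ht1, hqd]; ring_nf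
        _ = 1 / |q| * (t (n + 2) ^ (α + 1) * (t 1 / t (n + 2)) ^ (α + 1)) := by
            rw [← Real.mul_rpow htm.le hY.le, mul_div_cancel₀ _ htm.ne']
        _ ≤ _ := by
            gcongr 1 / |q| * (_ * ?_)
            exact Real.rpow_le_rpow_of_exponent_ge hY hY1 (min_le_left _ _)
    · have hb : (t (n + 1) ^ q - t 1 ^ q) / q ≤ 1 / |q| * t (n + 2) ^ q := by
        rw [abs_of_pos hpos, one_div_mul_eq_div]
        have h1 : 0 < t 1 ^ q := by positivity
        have h2 : t (n + 1) ^ q ≤ t (n + 2) ^ q :=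
          Real.rpow_le_rpow htn.le (hm.le (by omega) hn) hpos.le
        gcongr
        linarith
      calc t 1 ^ μ * ((t (n + 1) ^ q - t 1 ^ q) / q)
          ≤ t 1 ^ μ * (1 / |q| * t (n + 2) ^ q) := by gcongr
        _ = 1 / |q| * (t (n + 2) ^ (α + 1) * (t 1 / t (n + 2)) ^ μ) := by
            rw [Real.div_rpow ht1.le htm.le, hqd, Real.rpow_sub htm]
            ring
        _ ≤ _ := by
            gcongr 1 / |q| * (_ * ?_)
            exact Real.rpow_le_rpow_of_exponent_ge hY hY1 hμ1
  calc t 1 ^ μ * A / q * (t (n + 1) ^ q - t 1 ^ q)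
      = A * (t 1 ^ μ * ((t (n + 1) ^ q - t 1 ^ q) / q)) := by ring
    _ ≤ A * (1 / |q| * (t (n + 2) ^ (α + 1) * (t 1 / t (n + 2)) ^ ρ)) := by gcongr
    _ = _ := by ring

/-- The weighted sum of kernel increments over the intermediate intervals. -/
lemma QuasiGraded.exists_sum_weight_mul_kernel_le {α r c0 C0 : ℝ} (hα0 : 0 < α) (hr : 1 ≤ r)
    (hc0 : 0 < c0) (hcC : c0 ≤ C0) :
    ∃ K : ℝ, 0 ≤ K ∧ ∀ (T : ℝ) (M : ℕ) (t : ℕ → ℝ), IsMesh T M t → QuasiGraded r c0 C0 M t →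
      ∀ n : ℕ, n + 2 ≤ M →
        ∑ j ∈ Finset.Icc 2 (n + 1), (t 1 / t j) ^ (2 / r) * t j ^ α *
            ((t (n + 2) - t j) ^ (-α) - (t (n + 2) - t (j - 1)) ^ (-α)) ≤
          K * (t 1 / t (n + 2)) ^ min (α + 1) ((2 - α) / r) := by
  obtain ⟨K, hK0, hK⟩ := QuasiGraded.exists_sum_weight_mul_step_le hα0 hr hc0 hcC
  refine ⟨2 ^ (2 / r) * c0 ^ (-α) + α * 2 ^ (α + 1) * K, by positivity,
    fun T M t hm hq n hn => ?_⟩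
  specialize hK T M t hm hq n hn
  have hr0 : 0 < r := by linarith
  set c := t (n + 2) with hc
  set ρ := min (α + 1) ((2 - α) / r) with hρ
  have ht1 : 0 < t 1 := hm.pos le_rfl (by omega)
  have htm : 0 < c := hm.pos (by omega) hn
  have ht1m : t 1 ≤ c := hm.le (by omega) hn
  have hY : 0 < t 1 / c := by positivity
  have hY1 : t 1 / c ≤ 1 := (div_le_one htm).2 ht1m
  have hterm : ∀ j ∈ Finset.Icc 2 (n + 1), (t 1 / t j) ^ (2 / r) * t j ^ α *
        ((c - t j) ^ (-α) - (c - t (j - 1)) ^ (-α)) ≤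
      2 ^ (2 / r) * (t 1 / c) ^ (2 / r) * c ^ α *
        ((fun j => (c - t j) ^ (-α)) j - (fun j => (c - t j) ^ (-α)) (j - 1)) +
      α * 2 ^ (α + 1) * c ^ (-(α + 1)) *
        ((t 1 / t j) ^ (2 / r) * t j ^ α * (t j - t (j - 1))) := by
    intro j hj
    rw [Finset.mem_Icc] at hj
    have htj : 0 < t j := hm.pos (by omega) (by omega)
    have hst : t (j - 1) ≤ t j := hm.le (by omega) (by omega)
    have hjc : t j < c := hm.lt (by omega) hn
    have hD0 : 0 ≤ (c - t j) ^ (-α) - (c - t (j - 1)) ^ (-α) :=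
      sub_nonneg.2 (Real.rpow_le_rpow_of_nonpos (by linarith) (by linarith) (by linarith))
    have hs0 : 0 ≤ t j - t (j - 1) := by linarith
    rcases le_total (c / 2) (t j) with h | h
    · have h1 : (t 1 / t j) ^ (2 / r) ≤ 2 ^ (2 / r) * (t 1 / c) ^ (2 / r) := by
        rw [← Real.mul_rpow (by norm_num) hY.le]
        refine Real.rpow_le_rpow (by positivity) ?_ (by positivity)
        rw [← mul_div_assoc, div_le_div_iff₀ htj htm]
        nlinarith
      have h2 : t j ^ α ≤ c ^ α := Real.rpow_le_rpow htj.le hjc.le hα0.le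
      refine le_add_of_le_of_nonneg ?_ (by positivity)
      simp only
      gcongr
    · refine le_add_of_nonneg_of_le (by simp only; positivity) ?_
      have h1 := rpow_neg_sub_rpow_neg_le hα0 (x := c - t j) (y := c - t (j - 1))
        (by linarith) (by linarith)
      have h2 : (c - t j) ^ (-α - 1) ≤ 2 ^ (α + 1) * c ^ (-(α + 1)) := by
        have h3 : (c - t j) ^ (-α - 1) ≤ (c / 2) ^ (-α - 1) :=
          Real.rpow_le_rpow_of_nonpos (by linarith) (by linarith) (by linarith)
        refine h3.trans_eq ?_
        rw [show -α - 1 = -(α + 1) by ring, Real.div_rpow htm.le (by norm_num),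
          Real.rpow_neg (by norm_num : (0:ℝ) ≤ 2)]
        field_simp
      have h4 : (c - t j) ^ (-α) - (c - t (j - 1)) ^ (-α) ≤
          α * (t j - t (j - 1)) * (2 ^ (α + 1) * c ^ (-(α + 1))) := by
        refine h1.trans ?_
        rw [show c - t (j - 1) - (c - t j) = t j - t (j - 1) by ring]
        gcongr
      calc _ ≤ (t 1 / t j) ^ (2 / r) * t j ^ α *
            (α * (t j - t (j - 1)) * (2 ^ (α + 1) * c ^ (-(α + 1)))) := by gcongr
        _ = _ := by ring
  refine (Finset.sum_le_sum hterm).trans ?_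
  rw [Finset.sum_add_distrib, ← Finset.mul_sum, ← Finset.mul_sum,
    sum_Icc_two_sub_pred (fun j => (c - t j) ^ (-α)) n]
  have hlast : (c - t (n + 1)) ^ (-α) - (c - t 1) ^ (-α) ≤
      c0 ^ (-α) * (c ^ (-α) * (t 1 / c) ^ (-α / r)) := by
    have h1 : c0 * (c * (t 1 / c) ^ (1 / r)) ≤ c - t (n + 1) :=
      (hq.step_bounds hm (j := n + 2) (by omega) hn).1
    have h2 : (c - t (n + 1)) ^ (-α) ≤ (c0 * (c * (t 1 / c) ^ (1 / r))) ^ (-α) :=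
      Real.rpow_le_rpow_of_nonpos (by positivity) h1 (by linarith)
    rw [Real.mul_rpow hc0.le (by positivity), Real.mul_rpow htm.le (by positivity),
      ← Real.rpow_mul hY.le, show 1 / r * -α = -α / r by ring] at h2
    have h3 : 0 ≤ (c - t 1) ^ (-α) := Real.rpow_nonneg (by linarith) _
    linarith
  have hpow : (t 1 / c) ^ ((2 - α) / r) ≤ (t 1 / c) ^ ρ :=
    Real.rpow_le_rpow_of_exponent_ge hY hY1 (min_le_right _ _)
  have hfirst : 2 ^ (2 / r) * (t 1 / c) ^ (2 / r) * c ^ α *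
      ((c - t (n + 1)) ^ (-α) - (c - t 1) ^ (-α)) ≤
      2 ^ (2 / r) * c0 ^ (-α) * (t 1 / c) ^ ρ := by
    calc _ ≤ 2 ^ (2 / r) * (t 1 / c) ^ (2 / r) * c ^ α *
          (c0 ^ (-α) * (c ^ (-α) * (t 1 / c) ^ (-α / r))) := by gcongr
      _ = 2 ^ (2 / r) * c0 ^ (-α) * ((t 1 / c) ^ (2 / r) * (t 1 / c) ^ (-α / r)) *
          (c ^ α * c ^ (-α)) := by ring
      _ = 2 ^ (2 / r) * c0 ^ (-α) * (t 1 / c) ^ ((2 - α) / r) := by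
          rw [← Real.rpow_add hY, ← Real.rpow_add htm, add_neg_cancel, Real.rpow_zero, mul_one,
            show 2 / r + -α / r = (2 - α) / r by ring]
      _ ≤ _ := by gcongr
  have hsecond : α * 2 ^ (α + 1) * c ^ (-(α + 1)) *
      ∑ j ∈ Finset.Icc 2 (n + 1), (t 1 / t j) ^ (2 / r) * t j ^ α * (t j - t (j - 1)) ≤
      α * 2 ^ (α + 1) * K * (t 1 / c) ^ ρ := by
    calc _ ≤ α * 2 ^ (α + 1) * c ^ (-(α + 1)) * (K * (c ^ (α + 1) * (t 1 / c) ^ ρ)) := by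
          gcongr
      _ = α * 2 ^ (α + 1) * K * (t 1 / c) ^ ρ * (c ^ (-(α + 1)) * c ^ (α + 1)) := by ring
      _ = _ := by rw [← Real.rpow_add htm, neg_add_cancel, Real.rpow_zero, mul_one]
  rw [add_mul]
  exact add_le_add hfirst hsecond

/-- Contribution of the first interval at a later mesh point. -/
lemma abs_integral_first_interval_le {α κ a c P : ℝ} {g : ℝ → ℝ} (hα0 : 0 < α)
    (hκ : 0 < κ) (ha : 0 < a) (hac : a < c) (hgap : κ * c ≤ c - a) (hg : Measurable g)
    (hP : 0 ≤ P) (hgG : ∀ s ∈ Ioo 0 a, |g s| ≤ P * s ^ (α - 1))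
    (hg0 : ∫ s in (0:ℝ)..a, g s = 0) :
    IntervalIntegrable (fun s => (c - s) ^ (-α) * g s) volume 0 a ∧
    |∫ s in (0:ℝ)..a, (c - s) ^ (-α) * g s| ≤ κ ^ (-α - 1) * (a / c) ^ (α + 1) * P := by
  have hr : IntervalIntegrable (fun s : ℝ => P * s ^ (α - 1)) volume 0 a :=
    (intervalIntegral.intervalIntegrable_rpow' (by linarith)).const_mul P
  obtain ⟨h1, h2⟩ := abs_integral_kernel_mul_le hα0 ha.le hac hg hgG hr hg0
  refine ⟨h1, h2.trans ?_⟩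
  have hc : 0 < c := ha.trans hac
  rw [intervalIntegral.integral_const_mul, integral_rpow (Or.inl (by linarith)),
    sub_add_cancel, Real.zero_rpow hα0.ne', sub_zero, sub_zero]
  have h3 := rpow_neg_sub_rpow_neg_le hα0 (x := c - a) (y := c) (by linarith) (by linarith)
  have h4 : (c - a) ^ (-α - 1) ≤ κ ^ (-α - 1) * c ^ (-α - 1) := by
    rw [← Real.mul_rpow hκ.le hc.le]
    exact Real.rpow_le_rpow_of_nonpos (by positivity) hgap (by linarith)
  rw [sub_sub_cancel] at h3
  calc ((c - a) ^ (-α) - c ^ (-α)) * (P * (a ^ α / α))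
      ≤ (α * a * (κ ^ (-α - 1) * c ^ (-α - 1))) * (P * (a ^ α / α)) := by
        gcongr
        exact h3.trans (by gcongr)
    _ = κ ^ (-α - 1) * (a ^ α * a * c ^ (-α - 1)) * P := by field_simp
    _ = _ := by
        rw [Real.div_rpow ha.le hc.le, Real.rpow_add_one ha.ne',
          show -α - 1 = -(α + 1) by ring, Real.rpow_neg hc.le (α + 1)]
        ring

/-- Contribution of the interval adjacent to the singularity of the kernel. -/
lemma abs_integral_last_interval_le {α a b L : ℝ} {g : ℝ → ℝ} (hα1 : α < 1)
    (hab : a < b) (hg : Measurable g) (hgL : ∀ s ∈ Ioo a b, |g s| ≤ L) :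
    IntervalIntegrable (fun s => (b - s) ^ (-α) * g s) volume a b ∧
    |∫ s in a..b, (b - s) ^ (-α) * g s| ≤ L * ((b - a) ^ (1 - α) / (1 - α)) := by
  have h := intervalIntegrable_and_abs_integral_le_of_dominated
    (f := fun s => (b - s) ^ (-α) * g s) (G := fun s => L * (b - s) ^ (-α)) hab.le
    ((measurable_sub_rpow b (-α)).mul hg) ?_
    ((intervalIntegrable_sub_rpow hα1 a b b).const_mul L)
  · rwa [intervalIntegral.integral_const_mul, integral_sub_rpow hα1] at h
  · intro s hs
    have hp : 0 ≤ (b - s) ^ (-α) := Real.rpow_nonneg (by linarith [hs.2]) _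
    rw [abs_mul, abs_of_nonneg hp, mul_comm L]
    exact mul_le_mul_of_nonneg_left (hgL s hs) hp

/-- Truncation-error bound for the L1 operator on quasi-graded meshes (Lemma 3.3). -/
theorem stmt10 (α r T c0 C0 : ℝ)
    (hα0 : 0 < α) (hα1 : α < 1) (hr1 : 1 ≤ r)
    (hT : 0 < T) (hc0 : 0 < c0) (hcC : c0 ≤ C0) :
    ∃ C : ℝ, 0 < C ∧
      ∀ (M : ℕ) (t : ℕ → ℝ), IsMesh T M t → QuasiGraded r c0 C0 M t →
        ∀ u : ℝ → ℝ, ContinuousOn u (Set.Icc 0 T) → ContDiffOn ℝ 2 u (Set.Ioc 0 T) →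
          BddAbove ((fun s => s ^ (1 - α) *
            |(u (t 1) - u (t 0)) / (t 1 - t 0) - deriv u s|) '' Set.Ioo 0 (t 1)) →
          (∀ j : ℕ, 2 ≤ j → j ≤ M →
            BddAbove ((fun s => |deriv (deriv u) s|) '' Set.Ioo (t (j - 1)) (t j))) →
          ∀ (m : ℕ) (hm : 1 ≤ m), m ≤ M →
            |deltaL1 α t (fun j => u (t j)) m - caputo α u (t m)| ≤
              C * (t 1 / t m) ^ min (α + 1) ((2 - α) / r) *
                (Finset.Icc 1 m).sup' (Finset.nonempty_Icc.mpr hm) (psiL1 α t u) := by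
  have hr0 : 0 < r := by linarith
  have hC0 : 0 < C0 := hc0.trans_le hcC
  have h1α : 0 < 1 - α := by linarith
  have hΓ : 0 < Real.Gamma (1 - α) := Real.Gamma_pos_of_pos h1α
  obtain ⟨K, hK0, hK⟩ := QuasiGraded.exists_sum_weight_mul_kernel_le hα0 hr1 hc0 hcC
  set κ := c0 / (1 + c0) with hκd
  have hκ : 0 < κ := by positivity
  set B := 2 ^ α / α + 2 ^ (1 - α) / (1 - α) with hB
  have hB0 : 0 < B := by positivity
  refine ⟨1 / Real.Gamma (1 - α) *
    (B + κ ^ (-α - 1) + C0 ^ 2 * K + C0 ^ (2 - α) / (1 - α)), by positivity, ?_⟩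
  intro M t hmesh hq u huc hu2 hbd1 hbd2 m hm hmM
  set ρ := min (α + 1) ((2 - α) / r) with hρ
  set P := (Finset.Icc 1 m).sup' (Finset.nonempty_Icc.mpr hm) (psiL1 α t u) with hP
  have hψ : ∀ j, 1 ≤ j → j ≤ m → psiL1 α t u j ≤ P := fun j h1 h2 =>
    Finset.le_sup' (psiL1 α t u) (Finset.mem_Icc.2 ⟨h1, h2⟩)
  have ht1 : 0 < t 1 := hmesh.pos le_rfl (hm.trans hmM)
  have htm : 0 < t m := hmesh.pos hm hmM
  have hTM : t M = T := hmesh.2.2.2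
  have ht0 : t 0 = 0 := hmesh.2.1
  have hY : 0 < t 1 / t m := by positivity
  have hY1 : t 1 / t m ≤ 1 := (div_le_one htm).2 (hmesh.le hm hmM)
  have hYρ : 0 < (t 1 / t m) ^ ρ := by positivity
  -- regularity of `u`
  have hu2' : ContDiffOn ℝ 2 u (Ioo 0 T) := hu2.mono Ioo_subset_Ioc_self
  have hd : ∀ s ∈ Ioo 0 T, DifferentiableAt ℝ u s := fun s hs =>
    (hu2'.differentiableOn (by norm_num)).differentiableAt (isOpen_Ioo.mem_nhds hs)
  have hdd : ∀ s ∈ Ioo 0 T, DifferentiableAt ℝ (deriv u) s := fun s hs =>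
    ((hu2'.deriv_of_isOpen isOpen_Ioo (m := 1) (by norm_num)).differentiableOn
      (by norm_num)).differentiableAt (isOpen_Ioo.mem_nhds hs)
  have hsub : ∀ j, 1 ≤ j → j ≤ M → Icc (t (j - 1)) (t j) ⊆ Icc 0 T := fun j h1 h2 =>
    Icc_subset_Icc (ht0 ▸ hmesh.le (Nat.zero_le _) (by omega)) (hTM ▸ hmesh.le h2 le_rfl)
  have hsub' : ∀ j, 1 ≤ j → j ≤ M → Ioo (t (j - 1)) (t j) ⊆ Ioo 0 T := fun j h1 h2 =>
    Ioo_subset_Ioo (ht0 ▸ hmesh.le (Nat.zero_le _) (by omega)) (hTM ▸ hmesh.le h2 le_rfl)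
  have hlt : ∀ j, 1 ≤ j → j ≤ M → t (j - 1) < t j := fun j h1 h2 => hmesh.lt (by omega) h2
  set g : ℕ → ℝ → ℝ := fun j s =>
    (u (t j) - u (t (j - 1))) / (t j - t (j - 1)) - deriv u s with hg
  have hgm : ∀ j, Measurable (g j) := fun j => measurable_const.sub (measurable_deriv u)
  -- pointwise bounds
  have hfirst' : ∀ s ∈ Ioo 0 (t 1), s ^ (1 - α) * |g 1 s| ≤ P := by
    intro s hs
    refine le_trans ?_ (hψ 1 le_rfl hm)
    rw [psiL1, if_pos rfl]
    exact le_csSup hbd1 ⟨s, hs, rfl⟩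
  have hP0 : 0 ≤ P := le_trans (mul_nonneg (Real.rpow_nonneg (by linarith) _) (abs_nonneg _))
    (hfirst' (t 1 / 2) ⟨by linarith, by linarith⟩)
  have hfirst : ∀ s ∈ Ioo 0 (t 1), |g 1 s| ≤ P * s ^ (α - 1) := by
    intro s hs
    have hs0 : 0 < s := hs.1
    have h := hfirst' s hs
    rw [show α - 1 = -(1 - α) by ring, Real.rpow_neg hs0.le, ← div_eq_mul_inv,
      le_div_iff₀ (by positivity), mul_comm]
    exact h
  have hlater : ∀ j, 2 ≤ j → j ≤ m → ∀ s ∈ Ioo (t (j - 1)) (t j),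
      |g j s| ≤ P * t j ^ (α - 2) * (t j - t (j - 1)) := by
    intro j hj2 hjm s hs
    have htj : 0 < t j := hmesh.pos (by omega) (by omega)
    refine abs_slope_sub_deriv_le (hlt j (by omega) (by omega))
      (huc.mono (hsub j (by omega) (by omega)))
      (fun x hx => hd x (hsub' j (by omega) (by omega) hx))
      (fun x hx => hdd x (hsub' j (by omega) (by omega) hx)) (fun x hx => ?_) hs
    have h1 := hψ j (by omega) hjm
    rw [psiL1, if_neg (by omega)] at h1
    have h2 : |deriv (deriv u) x| ≤
        sSup ((fun s => |deriv (deriv u) s|) '' Set.Ioo (t (j - 1)) (t j)) :=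
      le_csSup (hbd2 j hj2 (hjm.trans hmM)) ⟨x, hx, rfl⟩
    rw [show α - 2 = -(2 - α) by ring, Real.rpow_neg htj.le, ← div_eq_mul_inv,
      le_div_iff₀ (by positivity), mul_comm]
    exact (mul_le_mul_of_nonneg_left h2 (by positivity)).trans h1
  have hmean1 : ∫ s in (0:ℝ)..(t 1), g 1 s = 0 := by
    have h := (integral_slope_sub_deriv (u := u) (hlt 1 le_rfl (hm.trans hmM))
      (huc.mono (hsub 1 le_rfl (hm.trans hmM)))
      (fun x hx => hd x (hsub' 1 le_rfl (hm.trans hmM) hx))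
      ((intervalIntegral.intervalIntegrable_rpow' (by linarith)).const_mul P)
      (fun s hs => hfirst s (by simpa [ht0] using hs))).2
    simpa [hg, ht0] using h
  have hmean : ∀ j, 2 ≤ j → j ≤ m → ∫ s in (t (j - 1))..(t j), g j s = 0 := by
    intro j hj2 hjm
    exact (integral_slope_sub_deriv (u := u) (hlt j (by omega) (by omega))
      (huc.mono (hsub j (by omega) (by omega)))
      (fun x hx => hd x (hsub' j (by omega) (by omega) hx))
      intervalIntegrable_const (hlater j hj2 hjm)).2
  -- it suffices to bound the sum of local contributions
  suffices hE : (∀ j ∈ Finset.Icc 1 m,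
      IntervalIntegrable (fun s => (t m - s) ^ (-α) * g j s) volume (t (j - 1)) (t j)) ∧
      ∑ j ∈ Finset.Icc 1 m, |∫ s in (t (j - 1))..(t j), (t m - s) ^ (-α) * g j s| ≤
        (B + κ ^ (-α - 1) + C0 ^ 2 * K + C0 ^ (2 - α) / (1 - α)) * (t 1 / t m) ^ ρ * P by
    rw [deltaL1_sub_caputo_eq hα1 m ht0 hE.1, abs_mul, abs_of_pos (by positivity), mul_assoc,
      mul_assoc (1 / Real.Gamma (1 - α))]
    refine mul_le_mul_of_nonneg_left ?_ (by positivity)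
    rw [← mul_assoc]
    exact (Finset.abs_sum_le_sum_abs _ _).trans hE.2
  have hκp : 0 < κ ^ (-α - 1) := by positivity
  rcases hm.eq_or_lt with rfl | hm2
  · obtain ⟨h1, h2⟩ := abs_integral_beta_kernel_le hα0 hα1 ht1 (hgm 1) hP0 hfirst
    simp only [Finset.Icc_self, Finset.mem_singleton, forall_eq, Finset.sum_singleton,
      Nat.sub_self, ht0]
    refine ⟨h1, h2.trans ?_⟩
    rw [div_self ht1.ne', Real.one_rpow, mul_one, mul_comm]
    refine mul_le_mul_of_nonneg_right ?_ hP0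
    have : 0 ≤ C0 ^ 2 * K := by positivity
    have : 0 ≤ C0 ^ (2 - α) / (1 - α) := by positivity
    linarith
  · obtain ⟨n, rfl⟩ : ∃ n, m = n + 2 := ⟨m - 2, by omega⟩
    set c := t (n + 2) with hc
    have hE1 := abs_integral_first_interval_le hα0 hκ ht1 (hmesh.lt (by omega) hmM)
      (hq.mul_le_sub_first hmesh hr1 hc0 (by omega) hmM) (hgm 1) hP0 hfirst hmean1
    have hEj : ∀ j ∈ Finset.Icc 2 (n + 1),
        IntervalIntegrable (fun s => (c - s) ^ (-α) * g j s) volume (t (j - 1)) (t j) ∧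
        |∫ s in (t (j - 1))..(t j), (c - s) ^ (-α) * g j s| ≤
          C0 ^ 2 * P * ((t 1 / t j) ^ (2 / r) * t j ^ α *
            ((c - t j) ^ (-α) - (c - t (j - 1)) ^ (-α))) := by
      intro j hj
      rw [Finset.mem_Icc] at hj
      have htj : 0 < t j := hmesh.pos (by omega) (by omega)
      have hst := hlt j (by omega) (by omega)
      have hjc : t j < c := hmesh.lt (by omega) hmM
      obtain ⟨h1, h2⟩ := abs_integral_kernel_mul_le hα0 hst.le hjc (hgm j)
        (hlater j hj.1 (by omega)) intervalIntegrable_const (hmean j hj.1 (by omega))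
      refine ⟨h1, h2.trans ?_⟩
      rw [intervalIntegral.integral_const, smul_eq_mul]
      have hD0 : 0 ≤ (c - t j) ^ (-α) - (c - t (j - 1)) ^ (-α) :=
        sub_nonneg.2 (Real.rpow_le_rpow_of_nonpos (by linarith) (by linarith) (by linarith))
      have hstep := (hq.step_bounds hmesh (j := j) (by omega) (by omega)).2
      have hsq : (t j - t (j - 1)) ^ 2 ≤ (C0 * (t j * (t 1 / t j) ^ (1 / r))) ^ 2 :=
        pow_le_pow_left₀ (by linarith) hstep 2
      have hyj : 0 < t 1 / t j := by positivity
      have e1 : ((t 1 / t j) ^ (1 / r)) ^ 2 = (t 1 / t j) ^ (2 / r) := by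
        rw [← Real.rpow_mul_natCast hyj.le]
        congr 1
        push_cast
        ring
      have e2 : t j ^ (α - 2) * t j ^ 2 = t j ^ α := by
        rw [← Real.rpow_natCast (t j) 2, ← Real.rpow_add htj]
        congr 1
        push_cast
        ring
      calc ((c - t j) ^ (-α) - (c - t (j - 1)) ^ (-α)) *
            ((t j - t (j - 1)) * (P * t j ^ (α - 2) * (t j - t (j - 1))))
          = ((c - t j) ^ (-α) - (c - t (j - 1)) ^ (-α)) * (P * t j ^ (α - 2)) *
              (t j - t (j - 1)) ^ 2 := by ring
        _ ≤ ((c - t j) ^ (-α) - (c - t (j - 1)) ^ (-α)) * (P * t j ^ (α - 2)) *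
              (C0 * (t j * (t 1 / t j) ^ (1 / r))) ^ 2 := by gcongr
        _ = C0 ^ 2 * P * (((t 1 / t j) ^ (1 / r)) ^ 2 * (t j ^ (α - 2) * t j ^ 2) *
              ((c - t j) ^ (-α) - (c - t (j - 1)) ^ (-α))) := by ring
        _ = _ := by rw [e1, e2]
    have hEm := abs_integral_last_interval_le hα1 (hlt (n + 2) hm hmM) (hgm (n + 2))
      (hlater (n + 2) (by omega) le_rfl)
    refine ⟨fun j hj => ?_, ?_⟩
    · rw [Finset.mem_Icc] at hj
      rcases hj.1.eq_or_lt with rfl | hj1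
      · simpa [ht0] using hE1.1
      · rcases hj.2.eq_or_lt with rfl | hj2
        · exact hEm.1
        · exact (hEj j (Finset.mem_Icc.2 ⟨hj1, by omega⟩)).1
    · rw [Finset.sum_Icc_succ_top (by omega), sum_Icc_one_eq_add]
      have b1 : |∫ s in (t (1 - 1))..(t 1), (c - s) ^ (-α) * g 1 s| ≤
          κ ^ (-α - 1) * (t 1 / c) ^ ρ * P := by
        simp only [Nat.sub_self, ht0]
        refine hE1.2.trans ?_
        gcongr ?_ * P
        refine mul_le_mul_of_nonneg_left ?_ hκp.le
        exact Real.rpow_le_rpow_of_exponent_ge hY hY1 (min_le_left _ _)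
      have b2 : ∑ j ∈ Finset.Icc 2 (n + 1),
          |∫ s in (t (j - 1))..(t j), (c - s) ^ (-α) * g j s| ≤
          C0 ^ 2 * K * (t 1 / c) ^ ρ * P := by
        refine (Finset.sum_le_sum fun j hj => (hEj j hj).2).trans ?_
        rw [← Finset.mul_sum]
        calc _ ≤ C0 ^ 2 * P * (K * (t 1 / c) ^ ρ) :=
              mul_le_mul_of_nonneg_left (hK T M t hmesh hq n hmM) (by positivity)
          _ = _ := by ring
      have b3 : |∫ s in (t (n + 2 - 1))..c, (c - s) ^ (-α) * g (n + 2) s| ≤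
          C0 ^ (2 - α) / (1 - α) * (t 1 / c) ^ ρ * P := by
        refine hEm.2.trans ?_
        have hw : 0 < c - t (n + 2 - 1) := sub_pos.2 (hlt (n + 2) hm hmM)
        have hstep := (hq.step_bounds hmesh hm hmM).2
        have e1 : (c - t (n + 2 - 1)) * (c - t (n + 2 - 1)) ^ (1 - α) =
            (c - t (n + 2 - 1)) ^ (2 - α) := by
          rw [show 2 - α = 1 - α + 1 by ring, Real.rpow_add_one hw.ne', mul_comm]
        have e2 : (c - t (n + 2 - 1)) ^ (2 - α) ≤
            C0 ^ (2 - α) * (c ^ (2 - α) * (t 1 / c) ^ ((2 - α) / r)) := by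
          refine (Real.rpow_le_rpow hw.le hstep (by linarith)).trans_eq ?_
          rw [Real.mul_rpow hC0.le (by positivity), Real.mul_rpow htm.le (by positivity),
            ← Real.rpow_mul hY.le, one_div_mul_eq_div]
        have e3 : c ^ (α - 2) * c ^ (2 - α) = 1 := by
          rw [← Real.rpow_add htm, show α - 2 + (2 - α) = 0 by ring, Real.rpow_zero]
        calc P * c ^ (α - 2) * (c - t (n + 2 - 1)) * ((c - t (n + 2 - 1)) ^ (1 - α) / (1 - α))
            = P * c ^ (α - 2) / (1 - α) *
              ((c - t (n + 2 - 1)) * (c - t (n + 2 - 1)) ^ (1 - α)) := by ring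
          _ ≤ P * c ^ (α - 2) / (1 - α) *
              (C0 ^ (2 - α) * (c ^ (2 - α) * (t 1 / c) ^ ((2 - α) / r))) := by
              rw [e1]
              gcongr
          _ = C0 ^ (2 - α) / (1 - α) * (t 1 / c) ^ ((2 - α) / r) * P *
              (c ^ (α - 2) * c ^ (2 - α)) := by ring
          _ = C0 ^ (2 - α) / (1 - α) * (t 1 / c) ^ ((2 - α) / r) * P := by rw [e3, mul_one]
          _ ≤ _ := by
              gcongr ?_ * P
              refine mul_le_mul_of_nonneg_left ?_ (by positivity)
              exact Real.rpow_le_rpow_of_exponent_ge hY hY1 (min_le_right _ _)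
      have b0 : 0 ≤ B * (t 1 / c) ^ ρ * P := by positivity
      calc _ ≤ κ ^ (-α - 1) * (t 1 / c) ^ ρ * P + C0 ^ 2 * K * (t 1 / c) ^ ρ * P +
            C0 ^ (2 - α) / (1 - α) * (t 1 / c) ^ ρ * P := add_le_add (add_le_add b1 b2) b3
        _ ≤ _ := by linarith
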